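/- Let V, Q_j, Q_j', P_j, P_j' be real numbers, let π_j, π_j' ∈ (0,1], and let search costs c, c' satisfy 0 ≤ c' < c. If V·Q_j − P_j − c/π_j ≥ V·Q_j' − P_j' − c/π_j' (business j has weakly higher search index at the higher cost c) and V·Q_j' − P_j' − c'/π_j' ≥ V·Q_j − P_j − c'/π_j (business j' has weakly higher search index at the lower cost c'), then π_j ≥ π_j' and V·Q_j' − P_j' ≥ V·Q_j − P_j. -/

import Mathlib

/-- Arithmetic core of Proposition 4.2 (shift of transactions when
search costs fall). -/
theorem search_index_swap_implies
    (V Qj Qj' Pj Pj' πj πj' c c' : ℝ)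
    (hπj0 : 0 < πj) (hπj1 : πj ≤ 1)
    (hπj'0 : 0 < πj') (hπj'1 : πj' ≤ 1)
    (hc'0 : 0 ≤ c') (hc'c : c' < c)
    (h1 : V * Qj - Pj - c / πj ≥ V * Qj' - Pj' - c / πj')
    (h2 : V * Qj' - Pj' - c' / πj' ≥ V * Qj - Pj - c' / πj) :
    πj ≥ πj' ∧ V * Qj' - Pj' ≥ V * Qj - Pj := by
  rw [div_eq_mul_inv, div_eq_mul_inv] at h1 h2
  have h_inv : πj⁻¹ ≤ πj'⁻¹ := by
    by_contra! h
    nlinarith [mul_pos (sub_pos.2 hc'c) (sub_pos.2 h)]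
  refine ⟨(inv_le_inv₀ hπj0 hπj'0).1 h_inv, ?_⟩
  linarith [mul_le_mul_of_nonneg_left h_inv hc'0]
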